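/- Let A be a finite alphabet, let the prediction space D be finite (or a bounded subset of a Euclidean space on which l(x,·) is Lipschitz uniformly in x), and let l : A × D → [0, l_max] be a bounded loss function. Then there exists a sequence {(Ψ,F)_n} of randomized scandictors for V_n, constructed independently of the underlying measure, such that for every stationary probability measure Q on A^{ℤ²}: lim_{n→∞} E_{Q_{V_n}} E[(1/|V_n|) L_{(Ψ,F)_n}(X_{V_n})] = U(l,Q), where the inner expectation is over the randomization of (Ψ,F)_n. That is, there exists a universal scandictor achieving the scandictability of every spatially stationary random field. -/

import Mathlib

open MeasureTheory Filter Real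

namespace Scandiction

variable {A D B : Type*}

/-- The sequence of sites visited by the scanner `Ψ` on the data array `x`:
the site visited at time `t` depends on the values observed at previously visited sites. -/
def visits (Ψ : ∀ t : ℕ, (Fin t → A) → B) (x : B → A) : ℕ → B
  | t => Ψ t fun i : Fin t => x (visits Ψ x i)
  decreasing_by exact i.isLt

/-- A scanner is valid if, for every data array, the visited sites enumerate all of `B`
without repetition. -/
def IsValidScan [Fintype B] (Ψ : ∀ t : ℕ, (Fin t → A) → B) : Prop :=
  ∀ x : B → A, Function.Bijective fun t : Fin (Fintype.card B) => visits Ψ x t.1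

/-- Cumulative loss of the scanner-predictor pair `(Ψ, F)` on the data array `x`. -/
noncomputable def cumLoss [Fintype B] (l : A → D → ℝ)
    (Ψ : ∀ t : ℕ, (Fin t → A) → B) (F : ∀ t : ℕ, (Fin t → A) → D) (x : B → A) : ℝ :=
  ∑ t : Fin (Fintype.card B),
    l (x (visits Ψ x t.1)) (F t.1 fun i : Fin t.1 => x (visits Ψ x i.1))

/-- A scandictor for the finite set of sites `B`, with alphabet `A` and prediction space `D`. -/
structure Scandictor (A D B : Type*) [Fintype B] where
  scan : ∀ t : ℕ, (Fin t → A) → B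
  pred : ∀ t : ℕ, (Fin t → A) → D
  valid : IsValidScan scan

/-- Cumulative loss of a scandictor. -/
noncomputable def sLoss [Fintype B] (l : A → D → ℝ) (S : Scandictor A D B) (x : B → A) : ℝ :=
  cumLoss l S.scan S.pred x

/-- Restriction of a configuration on `ℤ²` to the `n × n` square `V_n`. -/
def restrV {A : Type*} (n : ℕ) (x : ℤ × ℤ → A) : Fin n × Fin n → A :=
  fun p => x ((p.1 : ℤ), (p.2 : ℤ))

/-- Translation of a configuration by `i ∈ ℤ²`: `(τ_i x)_j = x_{j+i}`. -/
def shift {A : Type*} (i : ℤ × ℤ) (x : ℤ × ℤ → A) : ℤ × ℤ → A := fun j => x (j + i)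

/-- A probability measure on `A^{ℤ²}` is stationary if it is invariant under every
translation. -/
def Stationary {A : Type*} [MeasurableSpace A]
    (Q : MeasureTheory.Measure ((ℤ × ℤ) → A)) : Prop :=
  ∀ i : ℤ × ℤ, MeasureTheory.Measure.map (shift i) Q = Q

/-- The `n × n` scandictability of `Q`:
`U(l, Q_{V_n}) = inf over scandictors of E[(1/n²) L]`. -/
noncomputable def Uval {A D : Type*} [MeasurableSpace A]
    (l : A → D → ℝ) (Q : MeasureTheory.Measure ((ℤ × ℤ) → A)) (n : ℕ) : ℝ :=
  ⨅ S : Scandictor A D (Fin n × Fin n),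
    ∫ x, sLoss l S (restrV n x) / (n : ℝ) ^ 2 ∂Q

/-- A finite decision tree describing an adaptive scan together with its predictions: at a node
a site is visited with a prediction, and the observed value selects the subtree. -/
inductive ScanTree (A D B : Type*)
  | done : ScanTree A D B
  | node (b : B) (d : D) (next : A → ScanTree A D B) : ScanTree A D B

namespace ScanTree

variable {A D B C : Type*}

/-- The successive sites and predictions of a tree on the data array `x`. -/
def run : ScanTree A D B → (B → A) → List (B × D)
  | done, _ => []
  | node b d f, x => (b, d) :: (f (x b)).run x

/-- Relabel the sites of a tree. -/
def mapSites (g : C → B) : ScanTree A D C → ScanTree A D B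
  | done => done
  | node b d f => node (g b) d fun a => (f a).mapSites g

/-- The tree with a constant prediction that visits a list of sites in order. -/
def ofList (d : D) : List B → ScanTree A D B
  | [] => done
  | b :: bs => node b d fun _ => ofList d bs

open Classical in
/-- Run a tree, recording the observations in a configuration, and then continue with a tree
which depends on the recorded configuration. -/
noncomputable def seq (g : (B → A) → ScanTree A D B) : ScanTree A D B → (B → A) → ScanTree A D B
  | done, h => g h
  | node b d f, h => node b d fun a => (f a).seq g (Function.update h b a)

/-- The subtree reached after a list of observations. -/
def descend : ScanTree A D B → List A → ScanTree A D B
  | T, [] => T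
  | done, _ :: _ => done
  | node _ _ f, a :: as => (f a).descend as

/-- The site and prediction at the root of a tree. -/
def root (z : B × D) : ScanTree A D B → B × D
  | done => z
  | node b d _ => (b, d)

theorem run_mapSites (g : C → B) (T : ScanTree A D C) (x : B → A) :
    (T.mapSites g).run x = (T.run (x ∘ g)).map (Prod.map g id) := by
  induction T with
  | done => rfl
  | node b d f ih => simp [mapSites, run, ih]

theorem run_ofList (d : D) (L : List B) (x : B → A) :
    (ofList d L : ScanTree A D B).run x = L.map fun b => (b, d) := by
  induction L with
  | nil => rfl
  | cons b L ih => simp [ofList, run, ih]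

open Classical in
theorem run_seq (g : (B → A) → ScanTree A D B) (T : ScanTree A D B) (h x : B → A) :
    (T.seq g h).run x =
      T.run x ++ (g fun b => if b ∈ (T.run x).map Prod.fst then x b else h b).run x := by
  induction T generalizing h with
  | done => simp [seq, run]
  | node b d f ih =>
    simp only [seq, run, ih, List.cons_append, List.map_cons, List.mem_cons]
    congr 4
    funext c
    by_cases hc : c ∈ ((f (x b)).run x).map Prod.fst
    · simp [hc]
    · by_cases hb : c = b
      · subst hb; simp
      · simp [hc, hb]

theorem run_descend (T : ScanTree A D B) (x : B → A) (t : ℕ) :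
    (T.descend (((T.run x).take t).map fun q => x q.1)).run x = (T.run x).drop t := by
  induction t generalizing T with
  | zero => simp [descend]
  | succ t ih =>
    cases T with
    | done => simp [descend, run]
    | node b d f => simpa [descend, run] using ih (f (x b))

theorem root_eq (z : B × D) (T : ScanTree A D B) (x : B → A) :
    T.root z = (T.run x)[0]?.getD z := by
  cases T <;> simp [root, run]

/-- The site and prediction chosen by a tree after a sequence of observations. -/
def act (z : B × D) (T : ScanTree A D B) (t : ℕ) (h : Fin t → A) : B × D :=
  (T.descend (List.ofFn h)).root z

theorem act_eq (z : B × D) (T : ScanTree A D B) (x : B → A) (t : ℕ) (ht : t ≤ (T.run x).length)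
    (h : Fin t → A) (hh : ∀ i : Fin t, h i = x ((T.run x)[i.1]?.getD z).1) :
    T.act z t h = (T.run x)[t]?.getD z := by
  have hL : List.ofFn h = ((T.run x).take t).map fun q => x q.1 := by
    apply List.ext_getElem
    · simp [ht]
    · intro i h1 h2
      have hi : i < (T.run x).length := by simp at h1; omega
      simp [hh, hi]
  rw [act, hL, root_eq z _ x, run_descend]
  simp

theorem visits_act (z : B × D) (T : ScanTree A D B) (x : B → A) (t : ℕ)
    (ht : t ≤ (T.run x).length) :
    visits (fun t h => (T.act z t h).1) x t = ((T.run x)[t]?.getD z).1 := by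
  induction t using Nat.strong_induction_on with
  | _ t ih =>
    rw [visits]
    rw [act_eq z T x t ht]
    intro i
    rw [ih i.1 i.2 (by omega)]

/-- A tree that visits every site exactly once is a scandictor. -/
def toScandictor [Fintype B] (z : B × D) (T : ScanTree A D B)
    (hlen : ∀ x, (T.run x).length = Fintype.card B)
    (hnd : ∀ x, ((T.run x).map Prod.fst).Nodup) : Scandictor A D B where
  scan t h := (T.act z t h).1
  pred t h := (T.act z t h).2
  valid x := by
    rw [Fintype.bijective_iff_injective_and_card]
    refine ⟨fun s t hst => ?_, by simp⟩
    have hs : s.1 < (T.run x).length := (hlen x).symm ▸ s.2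
    have ht : t.1 < (T.run x).length := (hlen x).symm ▸ t.2
    simp only [visits_act z T x _ hs.le, visits_act z T x _ ht.le] at hst
    apply Fin.ext
    apply (List.Nodup.getElem_inj_iff (hnd x) (hi := by simpa using hs)
      (hj := by simpa using ht)).1
    simpa [hs, ht] using hst

theorem sLoss_toScandictor [Fintype B] (l : A → D → ℝ) (z : B × D) (T : ScanTree A D B)
    (hlen : ∀ x, (T.run x).length = Fintype.card B)
    (hnd : ∀ x, ((T.run x).map Prod.fst).Nodup) (x : B → A) :
    sLoss l (T.toScandictor z hlen hnd) x = ((T.run x).map fun q => l (x q.1) q.2).sum := by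
  have key : ∀ t : Fin (Fintype.card B),
      l (x (visits (fun t h => (T.act z t h).1) x t.1))
        (T.act z t.1 fun i : Fin t.1 => x (visits (fun t h => (T.act z t h).1) x i.1)).2 =
      ((T.run x).map fun q => l (x q.1) q.2)[t.1]'(by simp [hlen]) := by
    intro t
    have ht : t.1 < (T.run x).length := by simp [hlen]
    rw [visits_act z T x _ ht.le, act_eq z T x _ ht.le]
    · simp [ht]
    · intro i
      rw [visits_act z T x _ (by omega)]
  unfold sLoss cumLoss toScandictor
  simp only [key]
  rw [← List.sum_ofFn]
  congr 1
  apply List.ext_getElem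
  · simp [hlen]
  · simp

/-- The tree describing `k` steps of a scanner-predictor pair after `t` observations. -/
def ofScan (Ψ : ∀ t : ℕ, (Fin t → A) → B) (F : ∀ t : ℕ, (Fin t → A) → D) :
    ℕ → ∀ t : ℕ, (Fin t → A) → ScanTree A D B
  | 0, _, _ => done
  | k + 1, t, h => node (Ψ t h) (F t h) fun a => ofScan Ψ F k (t + 1) (Fin.snoc h a)

theorem run_ofScan (Ψ : ∀ t : ℕ, (Fin t → A) → B) (F : ∀ t : ℕ, (Fin t → A) → D) (x : B → A)
    (k t : ℕ) :
    (ofScan Ψ F k t fun i => x (visits Ψ x i)).run x =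
      (List.range' t k).map fun s => (visits Ψ x s, F s fun i : Fin s => x (visits Ψ x i)) := by
  induction k generalizing t with
  | zero => simp [ofScan, run]
  | succ k ih =>
    have hv : Ψ t (fun i => x (visits Ψ x i)) = visits Ψ x t := by
      conv_rhs => rw [visits]
    rw [ofScan, run, List.range'_succ, List.map_cons, ← ih, hv]
    congr 3
    funext i
    refine Fin.lastCases ?_ (fun j => ?_) i <;> simp

/-- The tree describing a scandictor. -/
def ofScandictor [Fintype B] (S : Scandictor A D B) : ScanTree A D B :=
  ofScan S.scan S.pred (Fintype.card B) 0 Fin.elim0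

theorem run_ofScandictor [Fintype B] (S : Scandictor A D B) (x : B → A) :
    (ofScandictor S).run x = (List.range (Fintype.card B)).map fun s =>
      (visits S.scan x s, S.pred s fun i : Fin s => x (visits S.scan x i)) := by
  rw [List.range_eq_range', ← run_ofScan, ofScandictor]
  congr 2
  funext i
  exact i.elim0

theorem sLoss_eq_ofScandictor [Fintype B] (l : A → D → ℝ) (S : Scandictor A D B) (x : B → A) :
    sLoss l S x = (((ofScandictor S).run x).map fun q => l (x q.1) q.2).sum := by
  rw [run_ofScandictor, sLoss, cumLoss, List.map_map, ← List.sum_ofFn]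
  congr 1
  apply List.ext_getElem <;> simp

theorem sites_ofScandictor [Fintype B] (S : Scandictor A D B) (x : B → A) :
    (((ofScandictor S).run x).map Prod.fst).Nodup ∧
      ∀ b, b ∈ ((ofScandictor S).run x).map Prod.fst := by
  have hv := S.valid x
  rw [run_ofScandictor, List.map_map]
  constructor
  · refine List.Nodup.map_on ?_ List.nodup_range
    intro s hs t ht hst
    rw [List.mem_range] at hs ht
    have := @hv.1 ⟨s, hs⟩ ⟨t, ht⟩ hst
    simpa using this
  · intro b
    obtain ⟨t, ht⟩ := hv.2 b
    exact List.mem_map.2 ⟨t.1, List.mem_range.2 t.2, ht⟩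

end ScanTree

open ScanTree

section Blocks

variable {A D B C E : Type*} [Fintype C]

open Classical in
/-- The data array known after the first `k` blocks have been scanned. -/
noncomputable def known (ι : ℕ → C → B) (h x : B → A) (k : ℕ) : B → A :=
  fun b => if ∃ j < k, ∃ p, ι j p = b then x b else h b

/-- The tree which scans the blocks `ι 0, …, ι (k - 1)` in succession, the `j`-th one by the
scandictor whose index is selected by `c j` from the data known so far. -/
noncomputable def blockTree (S : E → Scandictor A D C) (ι : ℕ → C → B) (c : ℕ → (B → A) → E)
    (h : B → A) : ℕ → ScanTree A D B
  | 0 => done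
  | k + 1 =>
    (blockTree S ι c h k).seq (fun y => (ofScandictor (S (c k y))).mapSites (ι k)) h

theorem run_blockTree (l : A → D → ℝ) (S : E → Scandictor A D C) (ι : ℕ → C → B)
    (c : ℕ → (B → A) → E) (h x : B → A) (K : ℕ)
    (hι : ∀ j < K, ∀ k < K, ∀ p q, ι j p = ι k q → j = k ∧ p = q) (k : ℕ) (hk : k ≤ K) :
    (((blockTree S ι c h k).run x).map Prod.fst).Nodup ∧
      (∀ b, b ∈ ((blockTree S ι c h k).run x).map Prod.fst ↔ ∃ j < k, ∃ p, ι j p = b) ∧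
      ((blockTree S ι c h k).run x).length = k * Fintype.card C ∧
      (((blockTree S ι c h k).run x).map fun q => l (x q.1) q.2).sum =
        ∑ j ∈ Finset.range k, sLoss l (S (c j (known ι h x j))) (x ∘ ι j) := by
  classical
  induction k with
  | zero => simp [blockTree, run]
  | succ k ih =>
    obtain ⟨h1, h2, h3, h4⟩ := ih (by omega)
    have hkn : (fun b => if b ∈ ((blockTree S ι c h k).run x).map Prod.fst then x b else h b) =
        known ι h x k := by
      funext b
      simp only [known, h2]
    have hrun : (blockTree S ι c h (k + 1)).run x = (blockTree S ι c h k).run x ++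
        ((ofScandictor (S (c k (known ι h x k)))).run (x ∘ ι k)).map (Prod.map (ι k) id) := by
      rw [blockTree, run_seq, ← run_mapSites, ← hkn]
    have hfst : (((ofScandictor (S (c k (known ι h x k)))).run (x ∘ ι k)).map
        (Prod.map (ι k) id)).map Prod.fst =
        (((ofScandictor (S (c k (known ι h x k)))).run (x ∘ ι k)).map Prod.fst).map (ι k) := by
      simp [List.map_map, Function.comp_def]
    obtain ⟨s1, s2⟩ := sites_ofScandictor (S (c k (known ι h x k))) (x ∘ ι k)
    rw [hrun]
    refine ⟨?_, ?_, ?_, ?_⟩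
    · rw [List.map_append, hfst, List.nodup_append]
      refine ⟨h1, s1.map fun p q hpq => (hι k (by omega) k (by omega) p q hpq).2, ?_⟩
      rintro b hb _ hb' rfl
      obtain ⟨j, hj, p, rfl⟩ := (h2 b).1 hb
      obtain ⟨q, -, hq⟩ := List.mem_map.1 hb'
      have := (hι k (by omega) j (by omega) q p hq).1
      omega
    · intro b
      rw [List.map_append, hfst, List.mem_append, h2, List.mem_map]
      constructor
      · rintro (⟨j, hj, hp⟩ | ⟨q, -, hq⟩)
        · exact ⟨j, by omega, hp⟩
        · exact ⟨k, by omega, q, hq⟩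
      · rintro ⟨j, hj, p, hp⟩
        rcases Nat.lt_succ_iff_lt_or_eq.1 hj with hj | rfl
        · exact Or.inl ⟨j, hj, p, hp⟩
        · exact Or.inr ⟨p, s2 p, hp⟩
    · rw [List.length_append, h3, List.length_map, run_ofScandictor]
      simp
      ring
    · rw [List.map_append, List.sum_append, h4, Finset.sum_range_succ, sLoss_eq_ofScandictor,
        List.map_map]
      rfl

/-- Blocks can be scanned in succession, with the scandictor used in each block selected from the
data known so far. -/
theorem exists_block_scandictor [Fintype B] [Nonempty A] [Nonempty B] [Nonempty D]
    (l : A → D → ℝ) (M : ℝ) (hl : ∀ a d, l a d ≤ M) (S : E → Scandictor A D C)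
    (ι : ℕ → C → B) (K : ℕ)
    (hι : ∀ j < K, ∀ k < K, ∀ p q, ι j p = ι k q → j = k ∧ p = q)
    (c : ℕ → (B → A) → E) (h : B → A) :
    ∃ T : Scandictor A D B, ∀ x, sLoss l T x ≤
      ∑ j ∈ Finset.range K, sLoss l (S (c j (known ι h x j))) (x ∘ ι j) +
        M * (Fintype.card B - K * Fintype.card C) := by
  classical
  obtain ⟨b₀⟩ := ‹Nonempty B›
  obtain ⟨d₀⟩ := ‹Nonempty D›
  set R : List B := (Finset.univ.filter fun b => ¬ ∃ j < K, ∃ p, ι j p = b).toList with hR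
  set P := blockTree S ι c h K with hP
  set T := P.seq (fun _ => ofList d₀ R) h with hT
  have hrun : ∀ x, T.run x = P.run x ++ R.map fun b => (b, d₀) := fun x => by
    rw [hT, run_seq, run_ofList]
  have hfst : ∀ x, (T.run x).map Prod.fst = (P.run x).map Prod.fst ++ R := fun x => by
    rw [hrun, List.map_append, List.map_map]
    simp [Function.comp_def]
  have hnd : ∀ x, ((T.run x).map Prod.fst).Nodup := fun x => by
    obtain ⟨h1, h2, -, -⟩ := run_blockTree l S ι c h x K hι K le_rfl
    rw [hfst, List.nodup_append]
    refine ⟨h1, Finset.nodup_toList _, ?_⟩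
    rintro b hb _ hb' rfl
    rw [hR, Finset.mem_toList, Finset.mem_filter] at hb'
    exact hb'.2 ((h2 b).1 hb)
  have hlen : ∀ x, (T.run x).length = Fintype.card B := fun x => by
    obtain ⟨-, h2, -, -⟩ := run_blockTree l S ι c h x K hι K le_rfl
    rw [← List.length_map (f := Prod.fst), ← List.toFinset_card_of_nodup (hnd x),
      Finset.card_eq_iff_eq_univ, Finset.eq_univ_iff_forall]
    intro b
    rw [List.mem_toFinset, hfst, List.mem_append, h2, hR, Finset.mem_toList, Finset.mem_filter]
    exact (em _).imp_right fun hb => ⟨Finset.mem_univ b, hb⟩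
  refine ⟨T.toScandictor (b₀, d₀) hlen hnd, fun x => ?_⟩
  obtain ⟨-, -, h3, h4⟩ := run_blockTree l S ι c h x K hι K le_rfl
  have hRlen : (R.length : ℝ) = Fintype.card B - K * Fintype.card C := by
    have := hlen x
    rw [hrun, List.length_append, h3, List.length_map] at this
    rw [← this]
    push_cast
    ring
  rw [sLoss_toScandictor, hrun, List.map_append, List.sum_append, h4, ← hRlen]
  gcongr
  have := List.sum_le_card_nsmul ((R.map fun b => (b, d₀)).map fun q => l (x q.1) q.2) M (by
    intro y hy
    obtain ⟨q, -, rfl⟩ := List.mem_map.1 hy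
    exact hl _ _)
  simpa [mul_comm] using this

end Blocks

theorem sLoss_nonneg {A D B : Type*} [Fintype B] (l : A → D → ℝ) (hl : ∀ a d, 0 ≤ l a d)
    (S : Scandictor A D B) (x : B → A) : 0 ≤ sLoss l S x := by
  unfold sLoss cumLoss
  exact Finset.sum_nonneg fun _ _ => hl _ _

theorem sLoss_le {A D B : Type*} [Fintype B] (l : A → D → ℝ) (M : ℝ) (hl : ∀ a d, l a d ≤ M)
    (S : Scandictor A D B) (x : B → A) : sLoss l S x ≤ M * Fintype.card B := by
  unfold sLoss cumLoss
  refine (Finset.sum_le_card_nsmul _ _ M fun _ _ => hl _ _).trans ?_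
  simp [mul_comm]

/-- Regret bound for the exponentially weighted average forecaster. -/
theorem exp_weights_regret {E : Type*} [Fintype E] [Nonempty E] (ℓ : ℕ → E → ℝ)
    (h0 : ∀ k e, 0 ≤ ℓ k e) (h1 : ∀ k e, ℓ k e ≤ 1) (η : ℝ) (hη : 0 < η) (hη1 : η ≤ 1) (K : ℕ)
    (e : E) :
    ∑ k ∈ Finset.range K, ∑ e', Real.exp (-η * ∑ j ∈ Finset.range k, ℓ j e') /
        (∑ e'', Real.exp (-η * ∑ j ∈ Finset.range k, ℓ j e'')) * ℓ k e' ≤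
      ∑ k ∈ Finset.range K, ℓ k e + Real.log (Fintype.card E) / η + η * K := by
  set v : ℕ → E → ℝ := fun k e' => Real.exp (-η * ∑ j ∈ Finset.range k, ℓ j e') with hv
  set W : ℕ → ℝ := fun k => ∑ e', v k e' with hW
  have hWpos : ∀ k, 0 < W k := fun k =>
    Finset.sum_pos (fun e' _ => Real.exp_pos _) Finset.univ_nonempty
  set f : ℕ → ℝ := fun k => ∑ e', v k e' / W k * ℓ k e' with hf
  have hstep : ∀ k, W (k + 1) ≤ W k * Real.exp (-η * f k + η ^ 2) := by
    intro k
    have hWf : W k * f k = ∑ e', v k e' * ℓ k e' := by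
      rw [hf, Finset.mul_sum]
      refine Finset.sum_congr rfl fun e' _ => ?_
      have := (hWpos k).ne'
      field_simp
    have hterm : ∀ e', v (k + 1) e' ≤ v k e' * (1 - η * ℓ k e' + η ^ 2) := by
      intro e'
      have : v (k + 1) e' = v k e' * Real.exp (-(η * ℓ k e')) := by
        simp only [hv, Finset.sum_range_succ, ← Real.exp_add]
        congr 1; ring
      rw [this]
      refine mul_le_mul_of_nonneg_left ?_ (Real.exp_pos _).le
      have hy0 : 0 ≤ η * ℓ k e' := mul_nonneg hη.le (h0 k e')
      have hy1 : η * ℓ k e' ≤ η := by nlinarith [h1 k e']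
      have := (abs_le.1 (Real.abs_exp_sub_one_sub_id_le (x := -(η * ℓ k e'))
        (by rw [abs_neg, abs_of_nonneg hy0]; linarith))).2
      nlinarith
    calc W (k + 1) ≤ ∑ e', v k e' * (1 - η * ℓ k e' + η ^ 2) :=
          Finset.sum_le_sum fun e' _ => hterm e'
      _ = W k * (1 + η ^ 2) - η * ∑ e', v k e' * ℓ k e' := by
          rw [hW, Finset.sum_mul, Finset.mul_sum, ← Finset.sum_sub_distrib]
          exact Finset.sum_congr rfl fun e' _ => by ring
      _ = W k * ((-η * f k + η ^ 2) + 1) := by rw [← hWf]; ring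
      _ ≤ _ := mul_le_mul_of_nonneg_left (Real.add_one_le_exp _) (hWpos k).le
  have hbound : ∀ k, W k ≤
      Fintype.card E * Real.exp (-η * ∑ j ∈ Finset.range k, f j + η ^ 2 * k) := by
    intro k
    induction k with
    | zero => simp [hW, hv]
    | succ k ih =>
      calc W (k + 1) ≤ W k * Real.exp (-η * f k + η ^ 2) := hstep k
        _ ≤ _ := mul_le_mul_of_nonneg_right ih (Real.exp_pos _).le
        _ = _ := by
          rw [mul_assoc, ← Real.exp_add, Finset.sum_range_succ]
          congr 2; push_cast; ring
  have hcard : (0 : ℝ) < Fintype.card E := by exact_mod_cast Fintype.card_pos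
  have hle : v K e ≤ W K := Finset.single_le_sum (f := v K) (fun e' _ => (Real.exp_pos _).le)
    (Finset.mem_univ e)
  have hlog := Real.log_le_log (Real.exp_pos _) (hle.trans (hbound K))
  rw [Real.log_exp, Real.log_mul hcard.ne' (Real.exp_pos _).ne', Real.log_exp] at hlog
  have hfin : η * ∑ k ∈ Finset.range K, f k ≤
      η * (∑ k ∈ Finset.range K, ℓ k e + Real.log (Fintype.card E) / η + η * K) := by
    have : η * (∑ k ∈ Finset.range K, ℓ k e + Real.log (Fintype.card E) / η + η * K) =
      η * ∑ k ∈ Finset.range K, ℓ k e + Real.log (Fintype.card E) + η ^ 2 * K := by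
      field_simp
    rw [this]; linarith
  exact le_of_mul_le_mul_left hfin hη

/-- A product of finitely many probability weights has total mass one. -/
theorem sum_prod_weights {J E : Type*} [Fintype J] [DecidableEq J] [Fintype E] (p : J → E → ℝ)
    (hp : ∀ j, ∑ e, p j e = 1) : ∑ ω : J → E, ∏ j, p j (ω j) = 1 := by
  rw [← Fintype.prod_sum]
  simp [hp]

/-- The marginals of a product of probability weights are its factors. -/
theorem sum_prod_weights_mul {J E : Type*} [Fintype J] [DecidableEq J] [Fintype E]
    (p : J → E → ℝ) (hp : ∀ j, ∑ e, p j e = 1) (i : J) (f : E → ℝ) :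
    ∑ ω : J → E, (∏ j, p j (ω j)) * f (ω i) = ∑ e, p i e * f e := by
  have h := Fintype.prod_sum fun j e => p j e * if j = i then f e else 1
  have h2 : ∀ j, ∑ e, p j e * (if j = i then f e else 1) =
      if j = i then ∑ e, p i e * f e else 1 := by
    intro j
    by_cases hj : j = i
    · subst hj; simp
    · simp [hj, hp]
  simp only [h2, Finset.prod_mul_distrib, Finset.prod_ite_eq', Finset.mem_univ, if_true] at h
  exact h.symm

/-- A bounded family of functions on a finite type has a finite uniform net. -/
theorem exists_finite_net {X I : Type*} [Fintype X] (L : I → X → ℝ) (M : ℝ)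
    (h0 : ∀ i x, 0 ≤ L i x) (hM : ∀ i x, L i x ≤ M) (ε : ℝ) (hε : 0 < ε) :
    ∃ s : Finset I, ∀ i, ∃ j ∈ s, ∀ x, L j x ≤ L i x + ε := by
  classical
  have hb : TotallyBounded (Set.range L) := by
    refine TotallyBounded.subset ?_
      (isCompact_Icc (a := (0 : X → ℝ)) (b := fun _ => M)).totallyBounded
    rintro _ ⟨i, rfl⟩
    exact ⟨fun x => h0 i x, fun x => hM i x⟩
  obtain ⟨t, hts, htf, htc⟩ := Metric.finite_approx_of_totallyBounded hb ε hε
  choose g hg using hts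
  have := htf.fintype
  refine ⟨Finset.univ.image fun y : t => g y.2, fun i => ?_⟩
  obtain ⟨y, hy, hiy⟩ := Set.mem_iUnion₂.1 (htc ⟨i, rfl⟩)
  refine ⟨g hy, Finset.mem_image.2 ⟨⟨y, hy⟩, Finset.mem_univ _, rfl⟩, fun x => ?_⟩
  rw [hg hy]
  have h1 := (dist_le_pi_dist (L i) y x).trans_lt hiy
  rw [Real.dist_eq] at h1
  linarith [(abs_lt.1 h1).1]

/-- A randomized scandictor which scans disjoint blocks in succession competes with the best of
finitely many block scandictors on every data array. -/
theorem exists_randomized_block_scandictor {A D B C E : Type*} [Fintype A] [Fintype B] [Fintype C]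
    [Fintype E] [Nonempty A] [Nonempty B] [Nonempty C] [Nonempty D] [Nonempty E]
    (l : A → D → ℝ) (M : ℝ) (hM : 0 < M) (hl0 : ∀ a d, 0 ≤ l a d) (hl : ∀ a d, l a d ≤ M)
    (S : E → Scandictor A D C) (ι : ℕ → C → B) (K : ℕ)
    (hι : ∀ j < K, ∀ k < K, ∀ p q, ι j p = ι k q → j = k ∧ p = q)
    (η : ℝ) (hη : 0 < η) (hη1 : η ≤ 1) :
    ∃ (k : ℕ) (w : Fin k → ℝ) (T : Fin k → Scandictor A D B),
      (∀ i, 0 ≤ w i) ∧ ∑ i, w i = 1 ∧ ∀ x e, ∑ i, w i * sLoss l (T i) x ≤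
        ∑ j ∈ Finset.range K, sLoss l (S e) (x ∘ ι j) +
          M * Fintype.card C * (Real.log (Fintype.card E) / η + η * K) +
          M * (Fintype.card B - K * Fintype.card C) := by
  classical
  obtain ⟨e₀⟩ := ‹Nonempty E›
  obtain ⟨a₀⟩ := ‹Nonempty A›
  have hne : Nonempty E := ⟨e₀⟩
  have hneA : Nonempty A := ⟨a₀⟩
  have hC : (0 : ℝ) < M * Fintype.card C := mul_pos hM (by exact_mod_cast Fintype.card_pos)
  set h : B → A := fun _ => a₀
  set ℓ : (B → A) → ℕ → E → ℝ := fun y j e => sLoss l (S e) (y ∘ ι j) / (M * Fintype.card C) with hℓ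
  set p : ℕ → (B → A) → E → ℝ := fun k y e =>
    Real.exp (-η * ∑ j ∈ Finset.range k, ℓ y j e) /
      ∑ e', Real.exp (-η * ∑ j ∈ Finset.range k, ℓ y j e') with hp
  have hZ : ∀ k y, 0 < ∑ e', Real.exp (-η * ∑ j ∈ Finset.range k, ℓ y j e') := fun k y =>
    Finset.sum_pos (fun e' _ => Real.exp_pos _) Finset.univ_nonempty
  have hp0 : ∀ k y e, 0 ≤ p k y e := fun k y e => div_nonneg (Real.exp_pos _).le (hZ k y).le
  have hp1 : ∀ k y, ∑ e, p k y e = 1 := fun k y => by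
    rw [hp, ← Finset.sum_div, div_self (hZ k y).ne']
  set q : Fin K × (B → A) → E → ℝ := fun j => p j.1 j.2 with hq
  have hq1 : ∀ j, ∑ e, q j e = 1 := fun j => hp1 _ _
  set c : (Fin K × (B → A) → E) → ℕ → (B → A) → E := fun ω k y =>
    if hk : k < K then ω (⟨k, hk⟩, y) else e₀ with hc
  choose T hT using fun ω => exists_block_scandictor l M hl S ι K hι (c ω) h
  set w : (Fin K × (B → A) → E) → ℝ := fun ω => ∏ j, q j (ω j) with hw
  have hw0 : ∀ ω, 0 ≤ w ω := fun ω => Finset.prod_nonneg fun j _ => hp0 _ _ _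
  have hw1 : ∑ ω, w ω = 1 := sum_prod_weights q hq1
  have hpk : ∀ k x, p k (known ι h x k) = p k x := by
    intro k x
    have : ∀ j ∈ Finset.range k, ∀ e, ℓ (known ι h x k) j e = ℓ x j e := by
      intro j hj e
      have hx : known ι h x k ∘ ι j = x ∘ ι j := by
        funext r
        simp only [known, Function.comp]
        rw [if_pos ⟨j, Finset.mem_range.1 hj, r, rfl⟩]
      simp only [hℓ, hx]
    have hsum : ∀ e, ∑ j ∈ Finset.range k, ℓ (known ι h x k) j e =
        ∑ j ∈ Finset.range k, ℓ x j e := fun e => Finset.sum_congr rfl fun j hj => this j hj e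
    funext e
    simp only [hp, hsum]
  have key : ∀ x e, ∑ ω, w ω * sLoss l (T ω) x ≤
        ∑ j ∈ Finset.range K, sLoss l (S e) (x ∘ ι j) +
          M * Fintype.card C * (Real.log (Fintype.card E) / η + η * K) +
          M * (Fintype.card B - K * Fintype.card C) := by
    intro x e
    have hreg := exp_weights_regret (ℓ x) (fun j e' => div_nonneg (sLoss_nonneg l hl0 _ _) hC.le)
      (fun j e' => (div_le_one hC).2 (sLoss_le l M hl _ _)) η hη hη1 K e
    have hreg' := mul_le_mul_of_nonneg_left hreg hC.le
    have hmarg : ∀ j ∈ Finset.range K,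
        ∑ ω, w ω * sLoss l (S (c ω j (known ι h x j))) (x ∘ ι j) =
          M * Fintype.card C * ∑ e', p j x e' * ℓ x j e' := by
      intro j hj
      have hjK := Finset.mem_range.1 hj
      simp only [hc, dif_pos hjK, hw]
      rw [sum_prod_weights_mul q hq1 (⟨j, hjK⟩, known ι h x j)
        fun e' => sLoss l (S e') (x ∘ ι j), Finset.mul_sum]
      refine Finset.sum_congr rfl fun e' _ => ?_
      simp only [hq, hpk, hℓ]
      field_simp
    calc ∑ ω, w ω * sLoss l (T ω) x
        ≤ ∑ ω, w ω * (∑ j ∈ Finset.range K, sLoss l (S (c ω j (known ι h x j))) (x ∘ ι j) +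
            M * (Fintype.card B - K * Fintype.card C)) :=
          Finset.sum_le_sum fun ω _ => mul_le_mul_of_nonneg_left (hT ω x) (hw0 ω)
      _ = ∑ j ∈ Finset.range K, ∑ ω, w ω * sLoss l (S (c ω j (known ι h x j))) (x ∘ ι j) +
            M * (Fintype.card B - K * Fintype.card C) := by
          simp only [mul_add, Finset.sum_add_distrib, ← Finset.sum_mul, hw1, one_mul,
            Finset.mul_sum]
          rw [Finset.sum_comm]
      _ = M * Fintype.card C * ∑ j ∈ Finset.range K, ∑ e', p j x e' * ℓ x j e' +
            M * (Fintype.card B - K * Fintype.card C) := by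
          rw [Finset.sum_congr rfl hmarg, ← Finset.mul_sum]
      _ ≤ _ := by
          gcongr
          refine hreg'.trans_eq ?_
          rw [mul_add, mul_add, mul_add, Finset.mul_sum, add_assoc]
          congr 1
          refine Finset.sum_congr rfl fun j _ => ?_
          simp only [hℓ]
          field_simp
  let φ := Fintype.equivFin (Fin K × (B → A) → E)
  refine ⟨_, w ∘ φ.symm, T ∘ φ.symm, fun i => hw0 _, ?_, fun x e => ?_⟩
  · rw [← hw1]
    exact Equiv.sum_comp φ.symm w
  · refine le_trans (le_of_eq ?_) (key x e)
    exact Equiv.sum_comp φ.symm fun ω => w ω * sLoss l (T ω) x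

theorem nonempty_scandictor (A : Type*) {D B : Type*} [Fintype B] [Nonempty B] [Nonempty D] :
    Nonempty (Scandictor A D B) := by
  obtain ⟨b⟩ := ‹Nonempty B›
  obtain ⟨d⟩ := ‹Nonempty D›
  refine ⟨(ScanTree.ofList d Finset.univ.toList).toScandictor (b, d) (fun x => ?_) fun x => ?_⟩
  · simp [ScanTree.run_ofList]
  · rw [ScanTree.run_ofList, List.map_map]
    simpa [Function.comp_def] using Finset.nodup_toList _

/-- Disjoint `m × m` translates inside the `N × N` square. -/
theorem exists_blocks (A : Type*) (m N : ℕ) (hN : 0 < N) :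
    ∃ (ι : ℕ → Fin m × Fin m → Fin N × Fin N) (o : ℕ → ℤ × ℤ),
      (∀ j < N / m * (N / m), ∀ k < N / m * (N / m), ∀ p q, ι j p = ι k q → j = k ∧ p = q) ∧
      ∀ (x : ℤ × ℤ → A), ∀ k < N / m * (N / m),
        restrV N x ∘ ι k = restrV m (shift (o k) x) := by
  have : NeZero N := ⟨hN.ne'⟩
  set a := N / m with ha
  have ham : m * a ≤ N := Nat.mul_div_le N m
  set ι : ℕ → Fin m × Fin m → Fin N × Fin N := fun k p =>
    (Fin.ofNat N (m * (k / a) + p.1), Fin.ofNat N (m * (k % a) + p.2)) with hι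
  have hlt : ∀ i < a, ∀ r < m, m * i + r < N := fun i hi r hr => by
    have : m * (i + 1) ≤ m * a := Nat.mul_le_mul_left m hi
    rw [Nat.mul_succ] at this
    omega
  have hdiv : ∀ k < a * a, k / a < a := fun k hk => Nat.div_lt_of_lt_mul hk
  have hmod : ∀ k < a * a, k % a < a := fun k hk =>
    Nat.mod_lt _ (Nat.pos_of_ne_zero (by rintro h; simp [h] at hk))
  have hval : ∀ k < a * a, ∀ p, ((ι k p).1 : ℕ) = m * (k / a) + p.1 ∧
      ((ι k p).2 : ℕ) = m * (k % a) + p.2 := fun k hk p =>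
    ⟨Nat.mod_eq_of_lt (hlt _ (hdiv k hk) _ p.1.2), Nat.mod_eq_of_lt (hlt _ (hmod k hk) _ p.2.2)⟩
  have huniq : ∀ i j r s : ℕ, r < m → s < m → m * i + r = m * j + s → i = j ∧ r = s := by
    intro i j r s hr hs h
    have h1 : (m * i + r) / m = i := by
      rw [Nat.mul_add_div (by omega), Nat.div_eq_of_lt hr, add_zero]
    have h2 : (m * j + s) / m = j := by
      rw [Nat.mul_add_div (by omega), Nat.div_eq_of_lt hs, add_zero]
    have hij : i = j := by rw [← h1, ← h2, h]
    subst hij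
    exact ⟨rfl, by omega⟩
  refine ⟨ι, fun k => ((m * (k / a) : ℕ), (m * (k % a) : ℕ)), ?_, ?_⟩
  · intro j hj k hk p q hjk
    obtain ⟨h1, h2⟩ := hval j hj p
    obtain ⟨h3, h4⟩ := hval k hk q
    rw [hjk] at h1 h2
    obtain ⟨e1, e2⟩ := huniq _ _ _ _ p.1.2 q.1.2 (h1.symm.trans h3)
    obtain ⟨e3, e4⟩ := huniq _ _ _ _ p.2.2 q.2.2 (h2.symm.trans h4)
    refine ⟨?_, Prod.ext (Fin.ext e2) (Fin.ext e4)⟩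
    rw [← Nat.div_add_mod j a, e1, e3, Nat.div_add_mod]
  · intro x k hk
    funext p
    obtain ⟨h1, h2⟩ := hval k hk p
    simp only [restrV, shift, Function.comp]
    congr 1
    ext
    · simp only [Prod.fst_add]
      rw [← Nat.cast_add, h1, add_comm]
    · simp only [Prod.snd_add]
      rw [← Nat.cast_add, h2, add_comm]

theorem measurable_shift {A : Type*} [MeasurableSpace A] (i : ℤ × ℤ) :
    Measurable (shift (A := A) i) :=
  measurable_pi_lambda _ fun _ => measurable_pi_apply _

section Measure

variable {A : Type*} [Fintype A] [MeasurableSpace A] [MeasurableSingletonClass A]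

theorem measurable_comp_restrV (n : ℕ) (f : (Fin n × Fin n → A) → ℝ) :
    Measurable fun x : ℤ × ℤ → A => f (restrV n x) := by
  have h : Measurable (restrV (A := A) n) := measurable_pi_lambda _ fun p => measurable_pi_apply _
  exact (measurable_of_finite f).comp h

theorem integrable_comp_restrV (Q : Measure (ℤ × ℤ → A)) [IsProbabilityMeasure Q] (n : ℕ)
    (f : (Fin n × Fin n → A) → ℝ) : Integrable (fun x => f (restrV n x)) Q := by
  obtain ⟨C, hC⟩ := (Set.finite_range fun y => ‖f y‖).bddAbove
  exact Integrable.of_bound (measurable_comp_restrV n f).aestronglyMeasurable C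
    (ae_of_all _ fun x => hC ⟨_, rfl⟩)

theorem Stationary.integral_shift {Q : Measure (ℤ × ℤ → A)} (hQ : Stationary Q) (i : ℤ × ℤ)
    (n : ℕ) (f : (Fin n × Fin n → A) → ℝ) :
    ∫ x, f (restrV n (shift i x)) ∂Q = ∫ x, f (restrV n x) ∂Q := by
  conv_rhs => rw [← hQ i]
  rw [integral_map (measurable_shift i).aemeasurable
    (measurable_comp_restrV n f).aestronglyMeasurable]

theorem Stationary.integrable_shift {Q : Measure (ℤ × ℤ → A)} [IsProbabilityMeasure Q]
    (hQ : Stationary Q) (i : ℤ × ℤ) (n : ℕ) (f : (Fin n × Fin n → A) → ℝ) :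
    Integrable (fun x => f (restrV n (shift i x))) Q := by
  have h := integrable_comp_restrV Q n f
  rw [← hQ i] at h
  exact h.comp_measurable (measurable_shift i)

/-- For every block size `m`, on large squares some randomized scandictor performs on all
stationary measures nearly as well as the optimal scandictor for `m × m` blocks. -/
theorem eventually_exists_randomized_scandictor {D : Type*} [Nonempty D] (l : A → D → ℝ) (M : ℝ)
    (hM : 0 < M) (hl0 : ∀ a d, 0 ≤ l a d) (hl : ∀ a d, l a d ≤ M) (m : ℕ) (hm : 0 < m) (ε : ℝ)
    (hε : 0 < ε) :
    ∀ᶠ n : ℕ in atTop, ∃ (k : ℕ) (w : Fin k → ℝ)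
      (T : Fin k → Scandictor A D (Fin (n + 1) × Fin (n + 1))),
      (∀ i, 0 ≤ w i) ∧ ∑ i, w i = 1 ∧
      ∀ Q : Measure (ℤ × ℤ → A), IsProbabilityMeasure Q → Stationary Q →
        ∑ i, w i * ∫ x, sLoss l (T i) (restrV (n + 1) x) / ((n : ℝ) + 1) ^ 2 ∂Q ≤
          Uval l Q m + 5 * ε := by
  classical
  rcases isEmpty_or_nonempty A with hA | hA
  · refine Eventually.of_forall fun n => ?_
    obtain ⟨S⟩ := nonempty_scandictor A (D := D) (B := Fin (n + 1) × Fin (n + 1))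
    refine ⟨1, fun _ => 1, fun _ => S, by simp, by simp, fun Q hQ _ => ?_⟩
    exact (IsEmpty.false (Classical.choice (Measure.nonempty_of_neZero Q) 0)).elim
  have : Nonempty (Fin m × Fin m) := ⟨(⟨0, hm⟩, ⟨0, hm⟩)⟩
  have hmR : (0 : ℝ) < m := by exact_mod_cast hm
  have hne := nonempty_scandictor A (D := D) (B := Fin m × Fin m)
  obtain ⟨s, hs⟩ := exists_finite_net (fun S : Scandictor A D (Fin m × Fin m) => sLoss l S)
    (M * Fintype.card (Fin m × Fin m)) (sLoss_nonneg l hl0) (sLoss_le l M hl) (ε * m ^ 2)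
    (by positivity)
  have hsne : Nonempty s := by
    obtain ⟨S⟩ := hne
    obtain ⟨T, hT, -⟩ := hs S
    exact ⟨⟨T, hT⟩⟩
  set η : ℝ := min 1 (ε / M) with hη
  have hη0 : 0 < η := lt_min one_pos (by positivity)
  have hηM : M * η ≤ ε := by
    have := mul_le_mul_of_nonneg_left (min_le_right 1 (ε / M)) hM.le
    rwa [mul_div_cancel₀ _ hM.ne'] at this
  set C₁ : ℝ := M * m ^ 2 * (Real.log (Fintype.card s) / η)
  have hinv : Tendsto (fun n : ℕ => 1 / ((n : ℝ) + 1)) atTop (nhds 0) :=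
    tendsto_one_div_add_atTop_nhds_zero_nat
  have ht1 : ∀ᶠ n : ℕ in atTop, C₁ * (1 / ((n : ℝ) + 1)) ^ 2 ≤ ε :=
    (((hinv.pow 2).const_mul C₁).eventually_le_const (by simpa using hε))
  have ht2 : ∀ᶠ n : ℕ in atTop, M * (2 * m) * (1 / ((n : ℝ) + 1)) ≤ ε :=
    ((hinv.const_mul (M * (2 * m))).eventually_le_const (by simpa using hε))
  filter_upwards [ht1, ht2] with n h1 h2
  obtain ⟨ι, o, hι, ho⟩ := exists_blocks A m (n + 1) n.succ_pos
  set a := (n + 1) / m with ha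
  obtain ⟨k, w, T, hw0, hw1, hT⟩ := exists_randomized_block_scandictor l M hM hl0 hl
    (fun e : s => e.1) ι (a * a) hι η hη0 (min_le_left _ _)
  refine ⟨k, w, T, hw0, hw1, fun Q hQ hst => ?_⟩
  set N : ℝ := (n : ℝ) + 1 with hN
  have hN0 : 0 < N := by positivity
  obtain ⟨S, hS⟩ : ∃ S : Scandictor A D (Fin m × Fin m),
      ∫ x, sLoss l S (restrV m x) / (m : ℝ) ^ 2 ∂Q < Uval l Q m + ε :=
    exists_lt_of_ciInf_lt (lt_add_of_pos_right _ hε)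
  obtain ⟨S', hS's, hS'⟩ := hs S
  have hU0 : 0 ≤ Uval l Q m := Real.iInf_nonneg fun S => integral_nonneg fun x =>
    div_nonneg (sLoss_nonneg l hl0 _ _) (by positivity)
  have hI : ∫ x, sLoss l S' (restrV m x) ∂Q ≤ m ^ 2 * (Uval l Q m + 2 * ε) := by
    have h3 : ∫ x, sLoss l S' (restrV m x) ∂Q ≤ ∫ x, (sLoss l S (restrV m x) + ε * m ^ 2) ∂Q :=
      integral_mono (integrable_comp_restrV Q m (sLoss l S'))
        ((integrable_comp_restrV Q m (sLoss l S)).add (integrable_const _)) fun x => hS' _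
    rw [integral_add (integrable_comp_restrV Q m (sLoss l S)) (integrable_const _),
      integral_const, probReal_univ, one_smul] at h3
    rw [integral_div, div_lt_iff₀ (by positivity)] at hS
    linarith
  set R : ℝ := M * Fintype.card (Fin m × Fin m) *
      (Real.log (Fintype.card s) / η + η * ((a * a : ℕ) : ℝ)) +
    M * (Fintype.card (Fin (n + 1) × Fin (n + 1)) -
      ((a * a : ℕ) : ℝ) * Fintype.card (Fin m × Fin m)) with hR
  have hsum : ∑ i, w i * ∫ x, sLoss l (T i) (restrV (n + 1) x) ∂Q ≤
      ((a * a : ℕ) : ℝ) * ∫ x, sLoss l S' (restrV m x) ∂Q + R := by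
    calc ∑ i, w i * ∫ x, sLoss l (T i) (restrV (n + 1) x) ∂Q
        = ∫ x, ∑ i, w i * sLoss l (T i) (restrV (n + 1) x) ∂Q := by
          rw [integral_finsetSum _ fun i _ =>
            (integrable_comp_restrV Q (n + 1) (sLoss l (T i))).const_mul (w i)]
          simp only [integral_const_mul]
      _ ≤ ∫ x, (∑ j ∈ Finset.range (a * a), sLoss l S' (restrV m (shift (o j) x)) + R) ∂Q := by
          refine integral_mono (integrable_finsetSum _ fun i _ =>
              (integrable_comp_restrV Q (n + 1) (sLoss l (T i))).const_mul (w i))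
            ((integrable_finsetSum _ fun j _ => hst.integrable_shift (o j) m (sLoss l S')).add
              (integrable_const _)) fun x => ?_
          refine (hT (restrV (n + 1) x) ⟨S', hS's⟩).trans_eq ?_
          rw [add_assoc]
          congr 1
          exact Finset.sum_congr rfl fun j hj => by rw [ho x j (Finset.mem_range.1 hj)]
      _ = _ := by
          rw [integral_add (integrable_finsetSum _ fun j _ =>
              hst.integrable_shift (o j) m (sLoss l S')) (integrable_const _),
            integral_finsetSum _ fun j _ => hst.integrable_shift (o j) m (sLoss l S')]
          simp only [hst.integral_shift _ m (sLoss l S')]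
          simp
  have hle : (a : ℝ) * m ≤ N := by
    have := Nat.div_mul_le_self (n + 1) m
    rw [hN]
    exact_mod_cast this
  have hge : N ≤ a * m + m := by
    have := (Nat.lt_div_mul_add hm (a := n + 1)).le
    rw [hN]
    exact_mod_cast this
  have ha0 : (0 : ℝ) ≤ a * m := by positivity
  have hsq : ((a : ℝ) * m) ^ 2 ≤ N ^ 2 := pow_le_pow_left₀ ha0 hle 2
  have hgap : N ^ 2 - ((a : ℝ) * m) ^ 2 ≤ 2 * m * N := by nlinarith
  simp only [integral_div, ← mul_div_assoc]
  rw [← Finset.sum_div, div_le_iff₀ (by positivity)]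
  refine hsum.trans ?_
  have hI' := mul_le_mul_of_nonneg_left hI (by positivity : (0 : ℝ) ≤ (a : ℝ) * a)
  have hk1 : C₁ ≤ ε * N ^ 2 := by
    rw [one_div, inv_pow, ← div_eq_mul_inv, div_le_iff₀ (by positivity)] at h1
    exact h1
  have hk2 : M * (2 * m) * N ≤ ε * N ^ 2 := by
    rw [mul_one_div, div_le_iff₀ hN0] at h2
    nlinarith
  have hRle : R ≤ 3 * ε * N ^ 2 := by
    have hReq : R = C₁ + M * η * ((a : ℝ) * m) ^ 2 + M * (N ^ 2 - ((a : ℝ) * m) ^ 2) := by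
      rw [hR]
      simp only [Fintype.card_prod, Fintype.card_fin]
      push_cast
      rw [hN]
      ring
    have e1 : M * η * ((a : ℝ) * m) ^ 2 ≤ ε * N ^ 2 :=
      mul_le_mul hηM hsq (by positivity) hε.le
    have e2 := mul_le_mul_of_nonneg_left hgap hM.le
    rw [hReq]
    linarith
  have hmain : ((a : ℝ) * m) ^ 2 * (Uval l Q m + 2 * ε) ≤ N ^ 2 * (Uval l Q m + 2 * ε) :=
    mul_le_mul_of_nonneg_right hsq (by positivity)
  push_cast
  nlinarith

end Measure

/-- Diagonal selection from countably many eventual properties. -/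
theorem exists_tendsto_eventually {P : ℕ → ℕ → Prop} (hP : ∀ m, ∀ᶠ n in atTop, P m n) :
    ∃ φ : ℕ → ℕ, Tendsto φ atTop atTop ∧ ∀ᶠ n in atTop, P (φ n) n := by
  classical
  choose N hN using fun m => eventually_atTop.1 (hP m)
  refine ⟨fun n => Nat.findGreatest (fun m => N m ≤ n) n, ?_, ?_⟩
  · refine tendsto_atTop.2 fun b => ?_
    filter_upwards [eventually_ge_atTop (max b (N b))] with n hn
    exact Nat.le_findGreatest ((le_max_left _ _).trans hn) ((le_max_right _ _).trans hn)
  · filter_upwards [eventually_ge_atTop (N 0)] with n hn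
    exact hN _ _ (Nat.findGreatest_spec (P := fun m => N m ≤ n) (Nat.zero_le n) hn)

/-- (Sizes are parameterized as `(n+1) × (n+1)`; a randomized scandictor
is a probability mass function over a finite set of scandictors; the prediction space `D`
is a totally bounded pseudometric space — covering both the finite case and bounded subsets
of Euclidean space — on which the loss is Lipschitz uniformly in its first argument.)
There exists a sequence of randomized scandictors, independent of the underlying measure,
achieving the scandictability `U(l,Q) = lim_n U(l, Q_{V_n})` of every stationary
probability measure `Q` on `A^{ℤ²}` for finite `A`. -/
theorem statement7 {A D : Type*} [Fintype A] [MeasurableSpace A] [MeasurableSingletonClass A]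
    [PseudoMetricSpace D] [Nonempty D]
    (lmax : ℝ) (l : A → D → ℝ) (hl : ∀ a d, 0 ≤ l a d ∧ l a d ≤ lmax)
    (hD : TotallyBounded (Set.univ : Set D))
    (hLip : ∃ c : NNReal, ∀ a, LipschitzWith c (l a)) :
    ∃ (k : ℕ → ℕ) (w : (n : ℕ) → Fin (k n) → ℝ)
      (Sh : (n : ℕ) → Fin (k n) → Scandictor A D (Fin (n + 1) × Fin (n + 1))),
      (∀ n, (∀ i, 0 ≤ w n i) ∧ ∑ i, w n i = 1) ∧
      ∀ Q : MeasureTheory.Measure ((ℤ × ℤ) → A),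
        MeasureTheory.IsProbabilityMeasure Q → Stationary Q →
        ∀ u : ℝ, Filter.Tendsto (fun n => Uval l Q (n + 1)) Filter.atTop (nhds u) →
        Filter.Tendsto (fun n => ∑ i, w n i *
            ∫ x, sLoss l (Sh n i) (restrV (n + 1) x) / ((n : ℝ) + 1) ^ 2 ∂Q)
          Filter.atTop (nhds u) := by
  set M : ℝ := max lmax 1
  have hM : 0 < M := lt_max_of_lt_right one_pos
  have hl0 : ∀ a d, 0 ≤ l a d := fun a d => (hl a d).1
  have hlM : ∀ a d, l a d ≤ M := fun a d => (hl a d).2.trans (le_max_left _ _)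
  obtain ⟨φ, hφ, hev⟩ := exists_tendsto_eventually fun m =>
    eventually_exists_randomized_scandictor l M hM hl0 hlM (m + 1) m.succ_pos
      (1 / ((m : ℝ) + 1)) (by positivity)
  have hex : ∀ n : ℕ, ∃ (k : ℕ) (w : Fin k → ℝ)
      (T : Fin k → Scandictor A D (Fin (n + 1) × Fin (n + 1))),
      ((∀ i, 0 ≤ w i) ∧ ∑ i, w i = 1) ∧
      ((∃ (k : ℕ) (w : Fin k → ℝ)
        (T : Fin k → Scandictor A D (Fin (n + 1) × Fin (n + 1))),
        (∀ i, 0 ≤ w i) ∧ ∑ i, w i = 1 ∧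
        ∀ Q : Measure (ℤ × ℤ → A), IsProbabilityMeasure Q → Stationary Q →
          ∑ i, w i * ∫ x, sLoss l (T i) (restrV (n + 1) x) / ((n : ℝ) + 1) ^ 2 ∂Q ≤
            Uval l Q (φ n + 1) + 5 * (1 / ((φ n : ℝ) + 1))) →
        ∀ Q : Measure (ℤ × ℤ → A), IsProbabilityMeasure Q → Stationary Q →
          ∑ i, w i * ∫ x, sLoss l (T i) (restrV (n + 1) x) / ((n : ℝ) + 1) ^ 2 ∂Q ≤
            Uval l Q (φ n + 1) + 5 * (1 / ((φ n : ℝ) + 1))) := by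
    intro n
    by_cases h : ∃ (k : ℕ) (w : Fin k → ℝ)
        (T : Fin k → Scandictor A D (Fin (n + 1) × Fin (n + 1))),
        (∀ i, 0 ≤ w i) ∧ ∑ i, w i = 1 ∧
        ∀ Q : Measure (ℤ × ℤ → A), IsProbabilityMeasure Q → Stationary Q →
          ∑ i, w i * ∫ x, sLoss l (T i) (restrV (n + 1) x) / ((n : ℝ) + 1) ^ 2 ∂Q ≤
            Uval l Q (φ n + 1) + 5 * (1 / ((φ n : ℝ) + 1))
    · obtain ⟨k, w, T, h0, h1, hT⟩ := h
      exact ⟨k, w, T, ⟨h0, h1⟩, fun _ => hT⟩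
    · obtain ⟨S⟩ := nonempty_scandictor A (D := D) (B := Fin (n + 1) × Fin (n + 1))
      exact ⟨1, fun _ => 1, fun _ => S, by simp, fun h' => (h h').elim⟩
  choose k w T hw hT using hex
  refine ⟨k, w, T, hw, fun Q hQ hst u hu => ?_⟩
  refine tendsto_of_tendsto_of_tendsto_of_le_of_le' hu
    (h := fun n => Uval l Q (φ n + 1) + 5 * (1 / ((φ n : ℝ) + 1))) ?_ ?_ ?_
  · have h1 := (hu.comp hφ).add
      ((tendsto_one_div_add_atTop_nhds_zero_nat (𝕜 := ℝ)).comp hφ |>.const_mul 5)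
    simpa using h1
  · refine Eventually.of_forall fun n => ?_
    have hle : ∀ i, Uval l Q (n + 1) ≤
        ∫ x, sLoss l (T n i) (restrV (n + 1) x) / ((n : ℝ) + 1) ^ 2 ∂Q := fun i => by
      have hb : BddBelow (Set.range fun S : Scandictor A D (Fin (n + 1) × Fin (n + 1)) =>
          ∫ x, sLoss l S (restrV (n + 1) x) / ((n + 1 : ℕ) : ℝ) ^ 2 ∂Q) := by
        refine ⟨0, ?_⟩
        rintro _ ⟨S, rfl⟩
        exact integral_nonneg fun x => div_nonneg (sLoss_nonneg l hl0 _ _) (by positivity)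
      have := ciInf_le hb (T n i)
      push_cast at this
      simpa [Uval] using this
    calc Uval l Q (n + 1) = ∑ i, w n i * Uval l Q (n + 1) := by
          rw [← Finset.sum_mul, (hw n).2, one_mul]
      _ ≤ _ := Finset.sum_le_sum fun i _ => mul_le_mul_of_nonneg_left (hle i) ((hw n).1 i)
  · filter_upwards [hev] with n hn
    exact hT n hn Q hQ hst

end Scandiction
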